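/- arXiv:1212.6445 — 4 statements merged into one kernel-verified Lean document; each statement's English description precedes it below -/
import Mathlib

section
/- Let Θ ⊆ ℝ^{n−1} be open and φ : Θ → ℝⁿ a C² immersion with tangent vectors τ_i = ∂_iφ, first fundamental form g_{ij} = ⟨τ_i, τ_j⟩, g = det[g_{ij}] and [gⁱʲ] = [g_{ij}]⁻¹. Then for each index k one has Σ_{i,j} ⟨∂_i(√g · gⁱʲ τ_j), τ_k⟩ = 0 on Θ. -/
open scoped RealInnerProductSpace

lemma aux_jac {E : Type*} [NormedAddCommGroup E] [NormedSpace ℝ E] {m : ℕ}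
    (M : E → Matrix (Fin m) (Fin m) ℝ) (x : E) (M' : Fin m → Fin m → E →L[ℝ] ℝ)
    (h : ∀ i j, HasFDerivAt (fun y => M y i j) (M' i j) x) :
    HasFDerivAt (fun y => (M y).det) (∑ i, ∑ j, (M x).adjugate j i • M' i j) x := by
  let D : ContinuousMultilinearMap ℝ (fun _ : Fin m => Fin m → ℝ) ℝ :=
    { (Matrix.detRowAlternating (n := Fin m) (R := ℝ)).toMultilinearMap with
      cont := by
        change Continuous (fun A : Matrix (Fin m) (Fin m) ℝ => A.det)
        exact Continuous.matrix_det continuous_id }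
  have hD : ∀ A : Fin m → Fin m → ℝ, D A = Matrix.det (Matrix.of A) := fun A => rfl
  have hM : HasFDerivAt (fun y => (fun i j => M y i j : Fin m → Fin m → ℝ))
      (ContinuousLinearMap.pi fun i => ContinuousLinearMap.pi fun j => M' i j) x :=
    hasFDerivAt_pi.2 fun i => hasFDerivAt_pi.2 fun j => h i j
  have key := (D.hasFDerivAt (fun i j => M x i j)).comp x hM
  refine key.congr_fderiv ?_
  ext v
  simp only [ContinuousLinearMap.comp_apply, ContinuousMultilinearMap.linearDeriv_apply,
    ContinuousLinearMap.sum_apply, ContinuousLinearMap.smul_apply, smul_eq_mul]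
  refine Finset.sum_congr rfl fun i _ => ?_
  rw [hD]
  change ((M x).updateRow i (fun j => M' i j v)).det = _
  rw [← Matrix.cramer_transpose_apply, Matrix.cramer_eq_adjugate_mulVec]
  simp [Matrix.mulVec, dotProduct, ← Matrix.adjugate_transpose]

lemma aux_inv {E : Type*} [NormedAddCommGroup E] [NormedSpace ℝ E] {m : ℕ}
    (M : E → Matrix (Fin m) (Fin m) ℝ) (x : E) 
    (h : ∀ i j, DifferentiableAt ℝ (fun y => M y i j) x) (h0 : (M x).det ≠ 0) (i j : Fin m) :
    DifferentiableAt ℝ (fun y => (M y)⁻¹ i j) x := by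
  have hd := (aux_jac M x _ (fun i j => (h i j).hasFDerivAt)).differentiableAt
  have ha : DifferentiableAt ℝ (fun y => (M y).adjugate i j) x := by
    simp only [Matrix.adjugate_apply]
    have : ∀ a b, DifferentiableAt ℝ (fun y => (M y).updateRow j (Pi.single i 1) a b) x := by
      intro a b
      by_cases hab : a = j
      · subst hab; simp
      · simpa [Matrix.updateRow_ne hab] using h a b
    exact (aux_jac _ x _ (fun i j => (this i j).hasFDerivAt)).differentiableAt
  have : (fun y => (M y)⁻¹ i j) = fun y => ((M y).det)⁻¹ * (M y).adjugate i j := by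
    ext y; simp [Matrix.inv_def]
  rw [this]
  exact (hd.inv h0).mul ha

/-- For a `C²` immersion `φ : Θ → ℝⁿ` with tangent vectors `τ_i = ∂_iφ`,
first fundamental form `G = [g_{ij}]`, `g = det G`, `[gⁱʲ] = G⁻¹`, one has
`Σ_{i,j} ⟨∂_i(√g · gⁱʲ τ_j), τ_k⟩ = 0` on `Θ` for every `k`. -/
theorem stmt4 {n : ℕ} (Θ : Set (EuclideanSpace ℝ (Fin (n - 1))))
    (hΘ : IsOpen Θ)
    (φ : EuclideanSpace ℝ (Fin (n - 1)) → EuclideanSpace ℝ (Fin n))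
    (hφ : ContDiffOn ℝ 2 φ Θ)
    (τ : Fin (n - 1) → EuclideanSpace ℝ (Fin (n - 1)) → EuclideanSpace ℝ (Fin n))
    (hτ : ∀ i θ, τ i θ = fderiv ℝ φ θ (EuclideanSpace.single i 1))
    (himm : ∀ θ ∈ Θ, LinearIndependent ℝ (fun i => τ i θ))
    (G : EuclideanSpace ℝ (Fin (n - 1)) → Matrix (Fin (n - 1)) (Fin (n - 1)) ℝ)
    (hG : ∀ θ i j, G θ i j = ⟪τ i θ, τ j θ⟫) :
    ∀ θ ∈ Θ, ∀ k,
      (∑ i, ∑ j,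
        ⟪fderiv ℝ (fun θ' => (Real.sqrt (G θ').det * (G θ')⁻¹ i j) • τ j θ') θ
            (EuclideanSpace.single i 1), τ k θ⟫) = 0 := by
  intro θ hθ k
  have hnhds : Θ ∈ nhds θ := hΘ.mem_nhds hθ
  have hc : ContDiffAt ℝ 2 φ θ := hφ.contDiffAt hnhds
  have hd2 : DifferentiableAt ℝ (fderiv ℝ φ) θ :=
    (hc.fderiv_right (m := 1) (by norm_num)).differentiableAt (by norm_num)
  have hsym : IsSymmSndFDerivAt ℝ φ θ := hc.isSymmSndFDerivAt (by simp)
  let e : Fin (n - 1) → EuclideanSpace ℝ (Fin (n - 1)) := fun i => EuclideanSpace.single i 1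
  have hτ' : ∀ i, τ i = fun y => fderiv ℝ φ y (e i) := fun i => funext (hτ i)
  have hτd : ∀ i, DifferentiableAt ℝ (τ i) θ := by
    intro i; rw [hτ' i]; exact hd2.clm_apply (differentiableAt_const _)
  have hs : ∀ i j, fderiv ℝ (τ j) θ (e i) = fderiv ℝ (τ i) θ (e j) := by
    have : ∀ i j, fderiv ℝ (τ j) θ (e i) = fderiv ℝ (fderiv ℝ φ) θ (e i) (e j) := by
      intro i j
      rw [hτ' j, fderiv_clm_apply hd2 (differentiableAt_const _)]
      simp
    intro i j
    rw [this, this]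
    exact hsym _ _
  have hGe : ∀ i j, (fun y => G y i j) = fun y => ⟪τ i y, τ j y⟫ := fun i j =>
    funext fun y => hG y i j
  have hGd : ∀ i j, DifferentiableAt ℝ (fun y => G y i j) θ := by
    intro i j; rw [hGe]; exact (hτd i).inner ℝ (hτd j)
  have hG' : ∀ i j v, fderiv ℝ (fun y => G y i j) θ v
      = ⟪τ i θ, fderiv ℝ (τ j) θ v⟫ + ⟪fderiv ℝ (τ i) θ v, τ j θ⟫ := by
    intro i j v; rw [hGe, fderiv_inner_apply ℝ (hτd i) (hτd j)]
  have hpos : ∀ y ∈ Θ, 0 < (G y).det := by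
    intro y hy
    have : G y = Matrix.gram ℝ (fun i => τ i y) := by
      ext i j; rw [hG, Matrix.gram_apply]
    rw [this]
    exact (Matrix.posDef_gram_of_linearIndependent (himm y hy)).det_pos
  have hp := hpos θ hθ
  have hjac := aux_jac G θ _ (fun i j => (hGd i j).hasFDerivAt)
  have hsq := hjac.sqrt hp.ne'
  set F : Fin (n - 1) → Fin (n - 1) → EuclideanSpace ℝ (Fin (n - 1)) → ℝ :=
    fun i j y => Real.sqrt (G y).det * (G y)⁻¹ i j with hF
  have hFd : ∀ i j, DifferentiableAt ℝ (F i j) θ := fun i j =>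
    hsq.differentiableAt.mul (aux_inv G θ hGd hp.ne' i j)
  -- product rule termwise
  have h1 : ∀ i j, ⟪fderiv ℝ (fun y => F i j y • τ j y) θ (e i), τ k θ⟫
      = fderiv ℝ (fun y => F i j y * G y j k) θ (e i)
        - F i j θ * ⟪τ j θ, fderiv ℝ (τ i) θ (e k)⟫ := by
    intro i j
    rw [fderiv_fun_smul (hFd i j) (hτd j), fderiv_fun_mul (hFd i j) (hGd j k)]
    simp only [ContinuousLinearMap.add_apply, ContinuousLinearMap.smul_apply,
      ContinuousLinearMap.smulRight_apply, smul_eq_mul, hG', inner_add_left, inner_smul_left,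
      hs i k]
    simp only [hG]
    simp
    ring
  have h2 : ∀ i, ∑ j, fderiv ℝ (fun y => F i j y * G y j k) θ (e i)
      = if i = k then fderiv ℝ (fun y => Real.sqrt (G y).det) θ (e k) else 0 := by
    intro i
    have hev : (fun y => ∑ j, F i j y * G y j k) =ᶠ[nhds θ]
        fun y => Real.sqrt (G y).det * (if i = k then 1 else 0) := by
      filter_upwards [hnhds] with y hy
      have hm : ((G y)⁻¹ * G y) i k = (1 : Matrix _ _ ℝ) i k := by
        rw [Matrix.nonsing_inv_mul _ (hpos y hy).ne'.isUnit]
      rw [Matrix.mul_apply, Matrix.one_apply] at hm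
      simp only [hF, mul_assoc, ← Finset.mul_sum, hm]
    have hsum := fderiv_fun_sum (𝕜 := ℝ) (u := Finset.univ)
      (fun j _ => (hFd i j).mul (hGd j k))
    have := hsum.symm.trans hev.fderiv_eq
    have := congrArg (fun L => L (e i)) this
    simp only [ContinuousLinearMap.sum_apply] at this
    refine this.trans ?_
    by_cases hik : i = k
    · subst hik; simp
    · simp [hik]
  have hGsym : ∀ i j, (G θ)⁻¹ i j = (G θ)⁻¹ j i := by
    have : (G θ).transpose = G θ := by
      ext i j; rw [Matrix.transpose_apply, hG, hG, real_inner_comm]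
    intro i j
    conv_lhs => rw [← this, ← Matrix.transpose_nonsing_inv, Matrix.transpose_apply]
  have h3 : fderiv ℝ (fun y => Real.sqrt (G y).det) θ (e k)
      = ∑ i, ∑ j, F i j θ * ⟪τ j θ, fderiv ℝ (τ i) θ (e k)⟫ := by
    have hadj : ∀ i j, (G θ).adjugate j i = (G θ).det * (G θ)⁻¹ i j := by
      intro i j
      rw [hGsym i j, Matrix.inv_def]
      simp [hp.ne']
    have hswap : ∑ i, ∑ j, F i j θ * ⟪fderiv ℝ (τ i) θ (e k), τ j θ⟫
        = ∑ i, ∑ j, F i j θ * ⟪τ i θ, fderiv ℝ (τ j) θ (e k)⟫ := by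
      rw [Finset.sum_comm]
      refine Finset.sum_congr rfl fun i _ => Finset.sum_congr rfl fun j _ => ?_
      simp only [hF]
      rw [hGsym j i, real_inner_comm]
    have hcomm : ∑ i, ∑ j, F i j θ * ⟪τ j θ, fderiv ℝ (τ i) θ (e k)⟫
        = ∑ i, ∑ j, F i j θ * ⟪fderiv ℝ (τ i) θ (e k), τ j θ⟫ := by
      refine Finset.sum_congr rfl fun i _ => Finset.sum_congr rfl fun j _ => ?_
      rw [real_inner_comm]
    have hhalf : fderiv ℝ (fun y => Real.sqrt (G y).det) θ (e k)
        = 1 / 2 * ((∑ i, ∑ j, F i j θ * ⟪τ i θ, fderiv ℝ (τ j) θ (e k)⟫)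
          + ∑ i, ∑ j, F i j θ * ⟪fderiv ℝ (τ i) θ (e k), τ j θ⟫) := by
      rw [hsq.fderiv]
      simp only [ContinuousLinearMap.smul_apply, ContinuousLinearMap.sum_apply, smul_eq_mul,
        hG', hadj, ← Finset.sum_add_distrib, Finset.mul_sum]
      refine Finset.sum_congr rfl fun i _ => Finset.sum_congr rfl fun j _ => ?_
      have hr : (G θ).det = Real.sqrt (G θ).det * Real.sqrt (G θ).det :=
        (Real.mul_self_sqrt hp.le).symm
      have hr0 : Real.sqrt (G θ).det ≠ 0 := (Real.sqrt_pos.2 hp).ne'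
      simp only [hF]
      generalize Real.sqrt (G θ).det = r at hr hr0 ⊢
      rw [hr]
      field_simp
    rw [hhalf, hcomm, hswap]; ring
  change ∑ i, ∑ j, ⟪fderiv ℝ (fun y => F i j y • τ j y) θ (e i), τ k θ⟫ = 0
  simp only [h1, Finset.sum_sub_distrib, h2]
  rw [← h3]
  simp
end

section
/- Let Σ ⊂ ℝⁿ be a nonempty closed set, a > 0, and ν : Σ → ℝⁿ with |ν(p)| = 1 for all p ∈ Σ, such that for every p ∈ Σ the open balls B_a(p + aν(p)) and B_a(p − aν(p)) are disjoint from Σ. Then for every p ∈ Σ and r ∈ (−a, a), the point x = p + rν(p) satisfies dist(x, Σ) = |r|, and p is the unique point of Σ nearest to x. Consequently, the map X : Σ × (−a, a) → ℝⁿ, X(p, r) = p + rν(p), is injective. -/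
/-- Uniform two-sided ball condition: if `S ⊂ ℝⁿ` is nonempty and closed, `ν` is a
unit field on `S`, and for each `p ∈ S` the open balls of radius `a` centered at
`p ± aν(p)` are disjoint from `S`, then for `p ∈ S` and `|r| < a` the point
`x = p + rν(p)` satisfies `dist(x, S) = |r|` with `p` its unique nearest point on
`S`; consequently `X(p, r) = p + rν(p)` is injective on `S × (−a, a)`. -/
theorem stmt13 {n : ℕ} (S : Set (EuclideanSpace ℝ (Fin n)))
    (hSne : S.Nonempty) (hScl : IsClosed S) (a : ℝ) (ha : 0 < a)
    (ν : EuclideanSpace ℝ (Fin n) → EuclideanSpace ℝ (Fin n))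
    (hνunit : ∀ p ∈ S, ‖ν p‖ = 1)
    (hball : ∀ p ∈ S, Metric.ball (p + a • ν p) a ∩ S = ∅ ∧
      Metric.ball (p - a • ν p) a ∩ S = ∅) :
    (∀ p ∈ S, ∀ r : ℝ, |r| < a →
      Metric.infDist (p + r • ν p) S = |r| ∧
      ∀ q ∈ S, dist q (p + r • ν p) = |r| → q = p) ∧
    (∀ p ∈ S, ∀ p' ∈ S, ∀ r r' : ℝ, |r| < a → |r'| < a →
      p + r • ν p = p' + r' • ν p' → p = p' ∧ r = r') := by
  have key : ∀ p ∈ S, ∀ r : ℝ, |r| < a → ∀ q ∈ S,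
      (a - |r|) * ‖q - p‖ ^ 2 ≤ a * (dist q (p + r • ν p) ^ 2 - |r| ^ 2) := by
    intro p hp r hr q hq
    have hd : ∀ t : ℝ, dist q (p + t • ν p) ^ 2
        = ‖q - p‖ ^ 2 - 2 * (t * inner ℝ (q - p) (ν p)) + t ^ 2 := by
      intro t
      rw [dist_eq_norm, ← sub_sub, norm_sub_sq_real, inner_smul_right, norm_smul, hνunit p hp,
        mul_one, Real.norm_eq_abs, sq_abs]
    have h1 : a ≤ dist q (p + a • ν p) := by
      by_contra! h
      have : q ∈ Metric.ball (p + a • ν p) a ∩ S := ⟨h, hq⟩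
      rw [(hball p hp).1] at this
      exact this
    have h2 : a ≤ dist q (p + (-a) • ν p) := by
      by_contra! h
      have : q ∈ Metric.ball (p - a • ν p) a ∩ S := by
        refine ⟨?_, hq⟩
        rw [Metric.mem_ball, sub_eq_add_neg, ← neg_smul]
        exact h
      rw [(hball p hp).2] at this
      exact this
    have h1s := pow_le_pow_left₀ ha.le h1 2
    have h2s := pow_le_pow_left₀ ha.le h2 2
    rw [hd] at h1s h2s
    rw [hd, sq_abs]
    rcases abs_cases r with ⟨e, h⟩ | ⟨e, h⟩ <;> rw [e]
    · nlinarith [mul_le_mul_of_nonneg_left h1s h]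
    · nlinarith [mul_le_mul_of_nonneg_left h2s (neg_nonneg.2 h.le)]
  have self : ∀ p ∈ S, ∀ r : ℝ, dist p (p + r • ν p) = |r| := by
    intro p hp r
    rw [dist_self_add_right, norm_smul, hνunit p hp, mul_one, Real.norm_eq_abs]
  have A : ∀ p ∈ S, ∀ r : ℝ, |r| < a →
      Metric.infDist (p + r • ν p) S = |r| ∧
      ∀ q ∈ S, dist q (p + r • ν p) = |r| → q = p := by
    intro p hp r hr
    refine ⟨le_antisymm ?_ ?_, ?_⟩
    · rw [← self p hp r, dist_comm]
      exact Metric.infDist_le_dist_of_mem hp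
    · rw [Metric.le_infDist hSne]
      intro q hq
      rw [dist_comm]
      have h := key p hp r hr q hq
      have h0 : 0 ≤ (a - |r|) * ‖q - p‖ ^ 2 := mul_nonneg (sub_nonneg.2 hr.le) (sq_nonneg _)
      have h3 := nonneg_of_mul_nonneg_right (h0.trans h) ha
      exact le_of_sq_le_sq (sub_nonneg.1 h3) dist_nonneg
    · intro q hq e
      have h := key p hp r hr q hq
      rw [e, sub_self, mul_zero] at h
      have h3 : ‖q - p‖ ^ 2 ≤ 0 := nonpos_of_mul_nonpos_right h (sub_pos.2 hr)
      have h4 : ‖q - p‖ = 0 := pow_eq_zero_iff two_ne_zero |>.1 (le_antisymm h3 (sq_nonneg _))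
      exact sub_eq_zero.1 (norm_eq_zero.1 h4)
  refine ⟨A, ?_⟩
  intro p hp p' hp' r r' hr hr' e
  have habs : |r| = |r'| := by
    rw [← (A p hp r hr).1, ← (A p' hp' r' hr').1, e]
  have hpp : p' = p := (A p hp r hr).2 p' hp' (by rw [e, self p' hp', habs])
  subst hpp
  refine ⟨rfl, ?_⟩
  have hne : ν p' ≠ 0 := by
    intro h
    have := hνunit p' hp
    simp [h] at this
  exact smul_left_injective ℝ hne (add_left_cancel e)
end

section
/- Let Σ ⊂ ℝⁿ be a nonempty closed set, a > 0, and ν : Σ → ℝⁿ with |ν(p)| = 1 for all p ∈ Σ, such that for every p ∈ Σ the open balls B_a(p + aν(p)) and B_a(p − aν(p)) are disjoint from Σ. Then for every p ∈ Σ and every r with 0 < r < a, the function y ↦ dist(y, Σ) is (Fréchet) differentiable at x = p + rν(p), with derivative the linear functional v ↦ ⟨ν(p), v⟩; i.e. the gradient of the distance function at x equals ν(p). In particular, for the signed distance d_Σ one has ∇d_Σ(x) = ν_Σ(Π_Σ(x)) at all points x of the tubular neighborhood, where Π_Σ(x) is the nearest point to x on Σ. -/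
theorem aux_norm_deriv {n : ℕ} (w c x : EuclideanSpace ℝ (Fin n)) (t : ℝ) (ht : 0 < t)
    (hw : ‖w‖ = 1) (hx : x - c = t • w) :
    HasFDerivAt (fun y => ‖y - c‖) (innerSL ℝ w) x := by
  have hn : ‖x - c‖ = t := by rw [hx, norm_smul, hw, Real.norm_of_nonneg ht.le, mul_one]
  have h1 : HasFDerivAt (fun y => ‖y - c‖ ^ 2) _ x := ((hasFDerivAt_id x).sub_const c).norm_sq
  have h2 := h1.sqrt (by rw [hn]; positivity)
  have h3 : (fun y => √(‖y - c‖ ^ 2)) = fun y => ‖y - c‖ := by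
    funext y; exact Real.sqrt_sq (norm_nonneg _)
  rw [h3] at h2
  refine h2.congr_fderiv ?_
  rw [hn, Real.sqrt_sq ht.le]
  change (1 / (2 * t)) • 2 • (innerSL ℝ (x - c)).comp (ContinuousLinearMap.id ℝ _) = _
  rw [hx, ContinuousLinearMap.comp_id, map_smul, ← Nat.cast_smul_eq_nsmul ℝ, smul_smul, smul_smul]
  have : 1 / (2 * t) * (((2 : ℕ) : ℝ) * t) = 1 := by push_cast; field_simp
  rw [← mul_assoc] at this
  rw [this, one_smul]

theorem aux_squeeze {E : Type*} [NormedAddCommGroup E] [NormedSpace ℝ E] {f g h : E → ℝ}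
    {L : E →L[ℝ] ℝ} {x : E} (hg : HasFDerivAt g L x) (hh : HasFDerivAt h L x)
    (h1 : ∀ y, g y ≤ f y) (h2 : ∀ y, f y ≤ h y) (h3 : g x = h x) : HasFDerivAt f L x := by
  have e1 : f x = g x := le_antisymm (h3 ▸ h2 x) (h1 x)
  rw [hasFDerivAt_iff_isLittleO] at *
  refine Asymptotics.IsBigO.trans_isLittleO (Asymptotics.IsBigO.of_bound 1 ?_)
    (hg.norm_left.add hh.norm_left)
  refine Filter.Eventually.of_forall fun y => ?_
  simp only [Real.norm_eq_abs, one_mul]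
  refine le_trans ?_ (le_abs_self _)
  have a1 := h1 y
  have a2 := h2 y
  rw [abs_le]
  constructor
  · have := neg_abs_le (g y - g x - L (y - x))
    have := abs_nonneg (h y - h x - L (y - x))
    linarith
  · have := le_abs_self (h y - h x - L (y - x))
    have := abs_nonneg (g y - g x - L (y - x))
    linarith

/-- Under the uniform two-sided ball condition with radius `a`, the distance function
`y ↦ dist(y, S)` is Fréchet differentiable at `x = p + rν(p)` for `p ∈ S` and
`0 < r < a`, with derivative the linear functional `v ↦ ⟨ν(p), v⟩`; i.e. the
gradient of the distance function at `x` is `ν(p)` (equivalently, for the signed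
distance, `∇d_Σ(x) = ν_Σ(Π_Σ(x))` in the tubular neighborhood). -/
theorem stmt14 {n : ℕ} (S : Set (EuclideanSpace ℝ (Fin n)))
    (hSne : S.Nonempty) (hScl : IsClosed S) (a : ℝ) (ha : 0 < a)
    (ν : EuclideanSpace ℝ (Fin n) → EuclideanSpace ℝ (Fin n))
    (hνunit : ∀ p ∈ S, ‖ν p‖ = 1)
    (hball : ∀ p ∈ S, Metric.ball (p + a • ν p) a ∩ S = ∅ ∧
      Metric.ball (p - a • ν p) a ∩ S = ∅) :
    ∀ p ∈ S, ∀ r : ℝ, 0 < r → r < a →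
      HasFDerivAt (fun y => Metric.infDist y S) (innerSL ℝ (ν p))
        (p + r • ν p) := by
  intro p hp r hr hra
  have hν := hνunit p hp
  have hh := aux_norm_deriv (ν p) p (p + r • ν p) r hr hν (by abel)
  have hg := (aux_norm_deriv (-ν p) (p + a • ν p) (p + r • ν p) (a - r) (by linarith)
    (by rw [norm_neg, hν]) (by module)).const_sub a
  have hL : -(innerSL ℝ (-ν p)) = innerSL ℝ (ν p) := by simp
  rw [hL] at hg
  refine aux_squeeze hg hh (fun y => ?_) (fun y => ?_) ?_
  · refine (Metric.le_infDist hSne).2 fun q hq => ?_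
    have hq' : a ≤ dist q (p + a • ν p) := by
      by_contra hlt
      have : q ∈ Metric.ball (p + a • ν p) a ∩ S := ⟨not_le.1 hlt, hq⟩
      rw [(hball p hp).1] at this
      exact this
    have := dist_triangle q y (p + a • ν p)
    rw [dist_comm q y] at this
    rw [← dist_eq_norm]
    linarith
  · rw [← dist_eq_norm]
    exact Metric.infDist_le_dist_of_mem hp
  · have e1 : p + r • ν p - (p + a • ν p) = (r - a) • ν p := by module
    have e2 : p + r • ν p - p = r • ν p := by abel
    simp only [e1, e2, norm_smul, hν, Real.norm_eq_abs, abs_of_pos hr,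
      abs_of_neg (sub_neg.2 hra)]
    ring
end

section
/- For R > 0 and k ∈ ℕ let ψ_k(x) = c_k(1 − |x|²/R²)₊^k for x ∈ ℝⁿ, where c_k > 0 is chosen so that ∫_{ℝⁿ} ψ_k(x) dx = 1. If f : ℝⁿ → ℝ is continuous with support contained in the closed ball of radius R/2 centered at 0, then the convolution ψ_k * f agrees on the ball {|x| < R/2} with (the restriction of) a polynomial function in the coordinates x₁,…,x_n. In particular, ψ_k * f is real analytic on {|x| < R/2}. -/
open MeasureTheory

lemma stmt16_aux {n : ℕ} (f : EuclideanSpace ℝ (Fin n) → ℝ) (hf : Continuous f)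
    (hfc : HasCompactSupport f)
    (P : MvPolynomial (Fin n) C(EuclideanSpace ℝ (Fin n), ℝ)) :
    ∃ p : MvPolynomial (Fin n) ℝ, ∀ x : EuclideanSpace ℝ (Fin n),
      (∫ y, (MvPolynomial.eval
        (fun i => ContinuousMap.const (EuclideanSpace ℝ (Fin n)) (x i)) P) y * f y)
        = MvPolynomial.eval (fun i => x i) p := by
  refine ⟨∑ d ∈ P.support, MvPolynomial.monomial d (∫ y, (P.coeff d) y * f y), fun x => ?_⟩
  have h : ∀ y, (MvPolynomial.eval
        (fun i => ContinuousMap.const (EuclideanSpace ℝ (Fin n)) (x i)) P) y * f y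
      = ∑ d ∈ P.support, ((P.coeff d) y * f y) * ∏ i, x i ^ d i := by
    intro y
    rw [MvPolynomial.eval_eq', ContinuousMap.sum_apply, Finset.sum_mul]
    refine Finset.sum_congr rfl fun d _ => ?_
    simp only [ContinuousMap.mul_apply, ContinuousMap.prod_apply, ContinuousMap.pow_apply,
      ContinuousMap.const_apply]
    ring
  simp_rw [h]
  rw [integral_finset_sum]
  · rw [map_sum]
    refine Finset.sum_congr rfl fun d _ => ?_
    rw [integral_mul_const, MvPolynomial.eval_monomial, Finsupp.prod_fintype _ _ (by simp)]
  · intro d _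
    refine Integrable.mul_const ?_ _
    exact (((P.coeff d).continuous.mul hf).integrable_of_hasCompactSupport hfc.mul_left)

/-- If `f` is continuous with support in the closed ball of radius `R/2`, then the
convolution with the polynomial mollifier `ψ_k(x) = c_k(1 − |x|²/R²)₊^k` agrees on
`{|x| < R/2}` with a polynomial in the coordinates; in particular it is real
analytic there. -/
theorem stmt16 {n : ℕ} (R : ℝ) (hR : 0 < R) (k : ℕ) (c : ℝ) (hc : 0 < c)
    (ψ : EuclideanSpace ℝ (Fin n) → ℝ)
    (hψ : ∀ x, ψ x = c * (max (1 - ‖x‖ ^ 2 / R ^ 2) 0) ^ k)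
    (hnorm : ∫ x, ψ x = 1)
    (f : EuclideanSpace ℝ (Fin n) → ℝ) (hf : Continuous f)
    (hsupp : Function.support f ⊆ Metric.closedBall 0 (R / 2)) :
    (∃ p : MvPolynomial (Fin n) ℝ,
      ∀ x : EuclideanSpace ℝ (Fin n), ‖x‖ < R / 2 →
        (∫ y, ψ (x - y) * f y) = MvPolynomial.eval (fun i => x i) p) ∧
    AnalyticOnNhd ℝ (fun x => ∫ y, ψ (x - y) * f y)
      (Metric.ball 0 (R / 2)) := by
  have hfc : HasCompactSupport f :=
    HasCompactSupport.of_support_subset_isCompact (isCompact_closedBall _ _) hsupp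
  have key : ∃ p : MvPolynomial (Fin n) ℝ,
      ∀ x : EuclideanSpace ℝ (Fin n), ‖x‖ < R / 2 →
        (∫ y, ψ (x - y) * f y) = MvPolynomial.eval (fun i => x i) p := by
    let pr : Fin n → C(EuclideanSpace ℝ (Fin n), ℝ) := fun i => ⟨fun y => y i, by fun_prop⟩
    let K : ℝ → C(EuclideanSpace ℝ (Fin n), ℝ) := fun a => ContinuousMap.const _ a
    obtain ⟨p, hp⟩ := stmt16_aux f hf hfc
      (MvPolynomial.C (K c) * (1 - MvPolynomial.C (K (R ^ 2)⁻¹) *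
        ∑ i, (MvPolynomial.X i - MvPolynomial.C (pr i)) ^ 2) ^ k)
    refine ⟨p, fun x hx => ?_⟩
    rw [← hp x]
    refine integral_congr_ae (Filter.Eventually.of_forall fun y => ?_)
    by_cases hy : f y = 0
    · simp [hy]
    have hy2 : ‖y‖ ≤ R / 2 := by simpa using hsupp hy
    have hxy : ‖x - y‖ ≤ R := (norm_sub_le x y).trans (by linarith)
    have h1 : ‖x - y‖ ^ 2 / R ^ 2 ≤ 1 := by
      rw [div_le_one (by positivity)]
      gcongr
    have h2 : ‖x - y‖ ^ 2 = ∑ i, (x i - y i) ^ 2 := by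
      rw [EuclideanSpace.norm_sq_eq]
      simp
    simp only [hψ]
    rw [max_eq_left (by linarith), h2]
    simp [K, pr, ContinuousMap.sum_apply, div_eq_inv_mul]
  refine ⟨key, ?_⟩
  obtain ⟨p, hp⟩ := key
  have hA : AnalyticOnNhd ℝ (fun x : EuclideanSpace ℝ (Fin n) =>
      MvPolynomial.eval (fun i => x i) p) (Metric.ball 0 (R / 2)) := by
    have := AnalyticOnNhd.aeval_mvPolynomial (𝕜 := ℝ) (A := ℝ) (B := ℝ)
      (f := fun (x : EuclideanSpace ℝ (Fin n)) i => x i) (s := Metric.ball 0 (R / 2))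
      (fun i => (EuclideanSpace.proj (𝕜 := ℝ) i).analyticOnNhd _) p
    simpa [MvPolynomial.aeval_eq_eval] using this
  refine hA.congr Metric.isOpen_ball fun x hx => ?_
  exact (hp x (by simpa using hx)).symm
end
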